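/- arXiv:2008.06756 — 8 statements merged into one kernel-verified Lean document; each statement's English description precedes it below -/
import Mathlib

section
/- Let I ⊆ ℝ be an open interval, a ∈ I, and let K, H, f, g : ℝ → ℝ be continuous on I. Define the Volterra operators P_K(f)(x) := ∫_a^x K(t)·f(t) dt and P_H(g)(x) := ∫_a^x H(t)·g(t) dt (interval integrals). Then for every x ∈ I, P_K(f)(x)·P_H(g)(x) = P_K(f·P_H(g))(x) + P_H(P_K(f)·g)(x), i.e. the Volterra operators with phantom kernels satisfy the matching Rota-Baxter identity of weight 0. -/
open MeasureTheory intervalIntegral in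
/-- Fundamental theorem of calculus for a function continuous on an open order-connected set. -/
theorem ContinuousOn.hasDerivAt_integral_of_ordConnected {E : Type*} [NormedAddCommGroup E]
    [NormedSpace ℝ E] [CompleteSpace E] {I : Set ℝ} (hIopen : IsOpen I) (hIconn : I.OrdConnected)
    {a : ℝ} (ha : a ∈ I) {φ : ℝ → E} (hφ : ContinuousOn φ I) {t : ℝ} (ht : t ∈ I) :
    HasDerivAt (fun y => ∫ u in a..y, φ u) (φ t) t :=
  integral_hasDerivAt_right (hφ.mono (hIconn.uIcc_subset ha ht)).intervalIntegrable
    (hφ.stronglyMeasurableAtFilter hIopen t ht) (hφ.continuousAt (hIopen.mem_nhds ht))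

/-- For an open interval `I ⊆ ℝ`, `a ∈ I`, and `K, H, f, g` continuous
on `I`, the Volterra operators with phantom kernels `P_K(f)(x) = ∫_a^x K(t)f(t) dt` and
`P_H(g)(x) = ∫_a^x H(t)g(t) dt` satisfy the matching Rota-Baxter identity of weight 0:
`P_K(f)(x)·P_H(g)(x) = P_K(f·P_H(g))(x) + P_H(P_K(f)·g)(x)` for every `x ∈ I`. -/
theorem phantom_volterra_matching_rota_baxter
    (I : Set ℝ) (hIopen : IsOpen I) (hIconn : I.OrdConnected)
    (a : ℝ) (ha : a ∈ I) (K H f g : ℝ → ℝ)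
    (hK : ContinuousOn K I) (hH : ContinuousOn H I)
    (hf : ContinuousOn f I) (hg : ContinuousOn g I) :
    ∀ x ∈ I,
      (∫ t in a..x, K t * f t) * (∫ t in a..x, H t * g t) =
        (∫ t in a..x, K t * (f t * ∫ u in a..t, H u * g u)) +
          (∫ t in a..x, H t * ((∫ u in a..t, K u * f u) * g t)) := by
  intro x hx
  have hsub := hIconn.uIcc_subset ha hx
  have hKf : ContinuousOn (fun t => K t * f t) I := hK.mul hf
  have hHg : ContinuousOn (fun t => H t * g t) I := hH.mul hg
  have hu := fun t (ht : t ∈ I) => hKf.hasDerivAt_integral_of_ordConnected hIopen hIconn ha ht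
  have hv := fun t (ht : t ∈ I) => hHg.hasDerivAt_integral_of_ordConnected hIopen hIconn ha ht
  have hparts := intervalIntegral.integral_mul_deriv_eq_deriv_mul
    (fun t ht => hu t (hsub ht)) (fun t ht => hv t (hsub ht))
    (hKf.mono hsub).intervalIntegrable (hHg.mono hsub).intervalIntegrable
  simp only [intervalIntegral.integral_same, mul_zero, sub_zero] at hparts
  simp only [← mul_assoc (K _), mul_left_comm (H _), hparts, add_sub_cancel]
end

section
/- Let I ⊆ ℝ be an open interval and a ∈ I. Let k₁, h₁, k₂, h₂ : ℝ → ℝ be continuous on I with k₁ and k₂ nowhere zero on I. Define the separable Volterra operators P_i(f)(x) := k_i(x)·∫_a^x h_i(t)·f(t) dt for i = 1, 2, and the twists 𝔞_i(x) := k_i(x)/k_i(a). Then for all f, g continuous on I and all x ∈ I: P₁(f)(x)·P₂(g)(x) = 𝔞₁(x)·P₂(t ↦ 𝔞₁(t)⁻¹·P₁(f)(t)·g(t))(x) + 𝔞₂(x)·P₁(t ↦ 𝔞₂(t)⁻¹·f(t)·P₂(g)(t))(x). That is, the algebra of continuous functions on I with a family of separable Volterra operators is a matching twisted Rota-Baxter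 algebra with twists 𝔞_ω = k_ω(x)/k_ω(a). -/
/-- The Volterra operator with separable kernel `K(x,t) = k(x)h(t)` and lower limit `a`:
`P(f)(x) = k(x) · ∫_a^x h(t)f(t) dt`. -/
noncomputable def volterraSep (k h : ℝ → ℝ) (a : ℝ) (f : ℝ → ℝ) (x : ℝ) : ℝ :=
  k x * ∫ t in a..x, h t * f t

open intervalIntegral in
/-- A primitive of a function continuous on an open interval is differentiable there. -/
theorem hasDerivAt_integral_of_continuousOn {I : Set ℝ} (hIopen : IsOpen I)
    (hIconn : I.OrdConnected) {a x : ℝ} (ha : a ∈ I) (hx : x ∈ I) {u : ℝ → ℝ}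
    (hu : ContinuousOn u I) : HasDerivAt (fun y => ∫ t in a..y, u t) (u x) x :=
  integral_hasDerivAt_right (hu.mono (hIconn.uIcc_subset ha hx)).intervalIntegrable
    (hu.stronglyMeasurableAtFilter hIopen x hx) (hu.continuousAt (hIopen.mem_nhds hx))

open intervalIntegral in
/-- Integration by parts for a product of primitives: the Rota-Baxter identity of weight zero. -/
theorem integral_mul_integral_eq_add {I : Set ℝ} (hIopen : IsOpen I)
    (hIconn : I.OrdConnected) {a x : ℝ} (ha : a ∈ I) (hx : x ∈ I) {u v : ℝ → ℝ}
    (hu : ContinuousOn u I) (hv : ContinuousOn v I) :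
    (∫ t in a..x, u t) * (∫ t in a..x, v t) =
      (∫ t in a..x, (∫ s in a..t, u s) * v t) + ∫ t in a..x, u t * ∫ s in a..t, v s := by
  have hsub := hIconn.uIcc_subset ha hx
  have hU := fun y (hy : y ∈ Set.uIcc a x) =>
    hasDerivAt_integral_of_continuousOn hIopen hIconn ha (hsub hy) hu
  have hV := fun y (hy : y ∈ Set.uIcc a x) =>
    hasDerivAt_integral_of_continuousOn hIopen hIconn ha (hsub hy) hv
  have hparts := integral_mul_deriv_eq_deriv_mul hU hV
    (hu.mono hsub).intervalIntegrable (hv.mono hsub).intervalIntegrable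
  simp only [integral_same, mul_zero, sub_zero] at hparts
  linarith

/-- For an open interval `I ⊆ ℝ`, `a ∈ I`, separable kernels
`K_i(x,t) = k_i(x)h_i(t)` with `k_i` nowhere zero on `I`, the separable Volterra operators
`P_i` satisfy the weight-0 matching twisted Rota-Baxter identity with twists
`𝔞_i(x) = k_i(x)/k_i(a)`. -/
theorem separable_volterra_matching_twisted_rota_baxter
    (I : Set ℝ) (hIopen : IsOpen I) (hIconn : I.OrdConnected)
    (a : ℝ) (ha : a ∈ I)
    (k₁ h₁ k₂ h₂ : ℝ → ℝ)
    (hk₁ : ContinuousOn k₁ I) (hh₁ : ContinuousOn h₁ I)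
    (hk₂ : ContinuousOn k₂ I) (hh₂ : ContinuousOn h₂ I)
    (hk₁0 : ∀ x ∈ I, k₁ x ≠ 0) (hk₂0 : ∀ x ∈ I, k₂ x ≠ 0) :
    ∀ (f g : ℝ → ℝ), ContinuousOn f I → ContinuousOn g I →
      ∀ x ∈ I,
        volterraSep k₁ h₁ a f x * volterraSep k₂ h₂ a g x =
          (k₁ x / k₁ a) *
              volterraSep k₂ h₂ a
                (fun t => (k₁ t / k₁ a)⁻¹ * volterraSep k₁ h₁ a f t * g t) x +
            (k₂ x / k₂ a) *
              volterraSep k₁ h₁ a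
                (fun t => (k₂ t / k₂ a)⁻¹ * f t * volterraSep k₂ h₂ a g t) x := by
  intro f g hf hg x hx
  have hsub := hIconn.uIcc_subset ha hx
  have hparts := integral_mul_integral_eq_add hIopen hIconn ha hx (hh₁.mul hf) (hh₂.mul hg)
  have hleft : (∫ t in a..x, h₂ t * ((k₁ t / k₁ a)⁻¹ * volterraSep k₁ h₁ a f t * g t)) =
      k₁ a * ∫ t in a..x, (∫ s in a..t, h₁ s * f s) * (h₂ t * g t) := by
    rw [← intervalIntegral.integral_const_mul]
    refine intervalIntegral.integral_congr fun t ht => ?_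
    have := hk₁0 t (hsub ht)
    simp only [volterraSep]
    field_simp
  have hright : (∫ t in a..x, h₁ t * ((k₂ t / k₂ a)⁻¹ * f t * volterraSep k₂ h₂ a g t)) =
      k₂ a * ∫ t in a..x, (h₁ t * f t) * ∫ s in a..t, h₂ s * g s := by
    rw [← intervalIntegral.integral_const_mul]
    refine intervalIntegral.integral_congr fun t ht => ?_
    have := hk₂0 t (hsub ht)
    simp only [volterraSep]
    field_simp
  have hcancel₁ : k₁ x / k₁ a * k₁ a = k₁ x := div_mul_cancel₀ _ (hk₁0 a ha)
  have hcancel₂ : k₂ x / k₂ a * k₂ a = k₂ x := div_mul_cancel₀ _ (hk₂0 a ha)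
  simp only [Pi.mul_apply] at hparts
  rw [volterraSep, volterraSep, volterraSep, volterraSep, hleft, hright]
  linear_combination k₁ x * k₂ x * hparts -
    hcancel₁ * (k₂ x * ∫ t in a..x, (∫ s in a..t, h₁ s * f s) * (h₂ t * g t)) -
    hcancel₂ * (k₁ x * ∫ t in a..x, (h₁ t * f t) * ∫ s in a..t, h₂ s * g s)
end

section
/- Let I ⊆ ℝ be an open interval, a ∈ I, c ∈ ℝ a nonzero constant, and h : ℝ → ℝ continuous on I. Define the Volterra operator with phantom kernel P(f)(x) := c·∫_a^x h(t)·f(t) dt. Then for all f, g continuous on I and all x ∈ I: P(f)(x)·P(g)(x) = P(f·P(g))(x) + P(P(f)·g)(x); that is, a separable Volterra operator whose kernel factor k(x) is constant (a phantom kernel) is a Rota-Baxter operator of weight 0. -/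
/-- The Volterra operator with phantom kernel `K(x,t) = c·h(t)` (constant `k(x) = c`) and
lower limit `a`: `P(f)(x) = c · ∫_a^x h(t)f(t) dt`. -/
noncomputable def volterraPhantom (c : ℝ) (h : ℝ → ℝ) (a : ℝ) (f : ℝ → ℝ) (x : ℝ) : ℝ :=
  c * ∫ t in a..x, h t * f t

/-- Fundamental theorem of calculus for the Volterra operator with phantom kernel. -/
theorem hasDerivAt_volterraPhantom {I : Set ℝ} (hIopen : IsOpen I) (hIconn : I.OrdConnected)
    {a : ℝ} (ha : a ∈ I) (c : ℝ) {h f : ℝ → ℝ} (hh : ContinuousOn h I) (hf : ContinuousOn f I)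
    {x : ℝ} (hx : x ∈ I) :
    HasDerivAt (volterraPhantom c h a f) (c * (h x * f x)) x := by
  have hhf : ContinuousOn (fun t => h t * f t) I := hh.mul hf
  exact (intervalIntegral.integral_hasDerivAt_right
    (hhf.mono (hIconn.uIcc_subset ha hx)).intervalIntegrable
    (hhf.stronglyMeasurableAtFilter hIopen x hx)
    (hhf.continuousAt (hIopen.mem_nhds hx))).const_mul c

/-- For an open interval `I ⊆ ℝ`, `a ∈ I`, a nonzero constant `c` and `h`
continuous on `I`, the Volterra operator with phantom kernel
`P(f)(x) = c·∫_a^x h(t)f(t) dt` is a Rota-Baxter operator of weight 0: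
`P(f)(x)·P(g)(x) = P(f·P(g))(x) + P(P(f)·g)(x)` for all `f, g` continuous on `I`, `x ∈ I`. -/
theorem phantom_volterra_rota_baxter
    (I : Set ℝ) (hIopen : IsOpen I) (hIconn : I.OrdConnected)
    (a : ℝ) (ha : a ∈ I)
    (c : ℝ) (hc : c ≠ 0) (h : ℝ → ℝ) (hh : ContinuousOn h I) :
    ∀ (f g : ℝ → ℝ), ContinuousOn f I → ContinuousOn g I →
      ∀ x ∈ I,
        volterraPhantom c h a f x * volterraPhantom c h a g x =
          volterraPhantom c h a (fun t => f t * volterraPhantom c h a g t) x +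
            volterraPhantom c h a (fun t => volterraPhantom c h a f t * g t) x := by
  intro f g hf hg x hx
  have hsub : Set.uIcc a x ⊆ I := hIconn.uIcc_subset ha hx
  have derivF := fun t (ht : t ∈ Set.uIcc a x) =>
    hasDerivAt_volterraPhantom hIopen hIconn ha c hh hf (hsub ht)
  have derivG := fun t (ht : t ∈ Set.uIcc a x) =>
    hasDerivAt_volterraPhantom hIopen hIconn ha c hh hg (hsub ht)
  have contF : ContinuousOn (volterraPhantom c h a f) (Set.uIcc a x) :=
    fun t ht => (derivF t ht).continuousAt.continuousWithinAt
  have contG : ContinuousOn (volterraPhantom c h a g) (Set.uIcc a x) :=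
    fun t ht => (derivG t ht).continuousAt.continuousWithinAt
  have hh' := hh.mono hsub
  have hf' := hf.mono hsub
  have hg' := hg.mono hsub
  have parts := intervalIntegral.integral_deriv_mul_eq_sub derivF derivG
    (continuousOn_const.mul (hh'.mul hf')).intervalIntegrable
    (continuousOn_const.mul (hh'.mul hg')).intervalIntegrable
  have intFG : IntervalIntegrable (fun t => h t * (f t * volterraPhantom c h a g t))
      MeasureTheory.volume a x := (hh'.mul (hf'.mul contG)).intervalIntegrable
  have intGF : IntervalIntegrable (fun t => h t * (volterraPhantom c h a f t * g t))
      MeasureTheory.volume a x := (hh'.mul (contF.mul hg')).intervalIntegrable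
  have base : volterraPhantom c h a f a = 0 := by simp [volterraPhantom]
  rw [base, zero_mul, sub_zero] at parts
  rw [← parts, volterraPhantom.eq_1 c h a (fun t => f t * _),
    volterraPhantom.eq_1 c h a (fun t => _ * g t), ← mul_add,
    ← intervalIntegral.integral_add intFG intGF,
    ← intervalIntegral.integral_const_mul]
  congr 1
  ext t
  ring
end

section
/- Let k be a field of characteristic 0, R a commutative k-algebra, Ω a set, (P_ω)_{ω∈Ω} a family of k-linear maps R → R, (𝔞_ω)_{ω∈Ω} a family of units of R, and (λ_ω)_{ω∈Ω} a family of scalars in k. Define the conjugated operators P̌_ω : R → R by P̌_ω(r) := 𝔞_ω⁻¹·P_ω(𝔞_ω·r). Then the following are equivalent: (i) for all α, β ∈ Ω and all x, y ∈ R, P_α(x)·P_β(y) = 𝔞_α·P_β(𝔞_α⁻¹·P_α(x)·y) + 𝔞_β·P_α(𝔞_β⁻¹·x·P_β(y)) + λ_β·𝔞_β·P_α(𝔞_β⁻¹·x·y); (ii) for all α, β ∈ Ω and all x, y ∈ R, P̌_α(x)·P̌_β(y) = P̌_β(P̌_α(x)·y) + P̌_α(x·P̌_β(y)) + λ_β·P̌_α(x·y).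 In other words, (R, P_Ω) is an Ω-matching twisted Rota-Baxter algebra of weight λ_Ω with twist 𝔞_Ω if and only if (R, P̌_Ω) is an Ω-matching Rota-Baxter algebra of weight λ_Ω. -/
/-- The conjugated operator `P̌(r) := 𝔞⁻¹ · P(𝔞 · r)` of a linear operator `P` by a
unit `𝔞`. -/
def conjOp {k R : Type*} [CommSemiring k] [CommRing R] [Algebra k R]
    (P : R →ₗ[k] R) (a : Rˣ) : R → R :=
  fun r => (↑a⁻¹ : R) * P ((a : R) * r)

/-- The conjugated matching Rota-Baxter identity at `x`, `y` is the twisted identity at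
`a * x`, `b * y`. -/
theorem twisted_identity_iff_conjOp {k R : Type*} [CommSemiring k] [CommRing R] [Algebra k R]
    (P Q : R →ₗ[k] R) (a b : Rˣ) (c : k) (x y : R) :
    P (a * x) * Q (b * y) =
        (a : R) * Q ((↑a⁻¹ : R) * P (a * x) * (b * y)) +
          (b : R) * P ((↑b⁻¹ : R) * (a * x) * Q (b * y)) +
            c • ((b : R) * P ((↑b⁻¹ : R) * (a * x) * (b * y))) ↔
      conjOp P a x * conjOp Q b y =
        conjOp Q b (conjOp P a x * y) + conjOp P a (x * conjOp Q b y) +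
          c • conjOp P a (x * y) := by
  have ha : (↑a⁻¹ : R) * a = 1 := a.inv_mul
  have hb : (↑b⁻¹ : R) * b = 1 := b.inv_mul
  have h₁ : (↑a⁻¹ : R) * P (a * x) * (b * y) = b * (↑a⁻¹ * P (a * x) * y) := by ring
  have h₂ : (↑b⁻¹ : R) * (a * x) * Q (b * y) = a * (x * (↑b⁻¹ * Q (b * y))) := by ring
  have h₃ : (↑b⁻¹ : R) * (a * x) * (b * y) = a * (x * y) := by
    linear_combination (a * x * y : R) * hb
  rw [h₁, h₂, h₃, ← (a⁻¹ * b⁻¹).mul_right_inj]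
  simp only [conjOp, Units.val_mul, Algebra.smul_def]
  generalize Q (b * (↑a⁻¹ * P (a * x) * y)) = u
  generalize P (a * (x * (↑b⁻¹ * Q (b * y)))) = v
  generalize P (a * (x * y)) = w
  have hl : (↑a⁻¹ * ↑b⁻¹ : R) * (P (a * x) * Q (b * y)) =
      ↑a⁻¹ * P (a * x) * (↑b⁻¹ * Q (b * y)) := by ring
  have hr : (↑a⁻¹ * ↑b⁻¹ : R) * (a * u + b * v + algebraMap k R c * (b * w)) =
      ↑b⁻¹ * u + ↑a⁻¹ * v + algebraMap k R c * (↑a⁻¹ * w) := by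
    linear_combination (↑b⁻¹ * u : R) * ha +
      (↑a⁻¹ * v + algebraMap k R c * ↑a⁻¹ * w) * hb
  rw [hl, hr]

/-- Over a field `k` of characteristic 0, a commutative `k`-algebra `R`
with a family of `k`-linear operators `P_ω`, units `𝔞_ω` and weights `λ_ω ∈ k` is an
`Ω`-matching twisted Rota-Baxter algebra of weight `λ_Ω` with twist `𝔞_Ω` if and only if
`(R, P̌_Ω)` with `P̌_ω(r) = 𝔞_ω⁻¹·P_ω(𝔞_ω·r)` is an `Ω`-matching Rota-Baxter algebra of
weight `λ_Ω`. -/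
theorem matching_twisted_RB_iff_matching_RB
    (k : Type*) [Field k] [CharZero k]
    (R : Type*) [CommRing R] [Algebra k R]
    (Ω : Type*) (P : Ω → R →ₗ[k] R) (a : Ω → Rˣ) (lam : Ω → k) :
    (∀ (α β : Ω) (x y : R),
        P α x * P β y =
          (a α : R) * P β ((↑(a α)⁻¹ : R) * P α x * y) +
            (a β : R) * P α ((↑(a β)⁻¹ : R) * x * P β y) +
              lam β • ((a β : R) * P α ((↑(a β)⁻¹ : R) * x * y))) ↔
    (∀ (α β : Ω) (x y : R),
        conjOp (P α) (a α) x * conjOp (P β) (a β) y =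
          conjOp (P β) (a β) (conjOp (P α) (a α) x * y) +
            conjOp (P α) (a α) (x * conjOp (P β) (a β) y) +
              lam β • conjOp (P α) (a α) (x * y)) := by
  simp only [← twisted_identity_iff_conjOp]
  refine ⟨fun h α β x y => h α β _ _, fun h α β x y => ?_⟩
  simpa only [Units.mul_inv_cancel_left] using
    h α β ((↑(a α)⁻¹ : R) * x) ((↑(a β)⁻¹ : R) * y)
end

section
/- Let k be a field of characteristic 0 and (R, P_Ω, 𝔞_Ω) an Ω-matching twisted Rota-Baxter algebra of weight 0, i.e. a commutative k-algebra R with k-linear maps P_ω : R → R and units 𝔞_ω ∈ R^× satisfying P_α(x)P_β(y) = 𝔞_α P_β(𝔞_α⁻¹P_α(x)y) + 𝔞_β P_α(𝔞_β⁻¹xP_β(y)) for all x, y ∈ R and α, β ∈ Ω. For ω, ω' ∈ Ω define P̌_{ω,ω'} : R → R by P̌_{ω,ω'}(r) := 𝔞_{ω'}⁻¹·P_ω(𝔞_{ω'}·r). Then for all x, y ∈ R and all α, β, η, γ ∈ Ω: P̌_{α,η}(x)·P̌_{β,γ}(y) = 𝔞_α·𝔞_η⁻¹·P̌_{β,γ}(𝔞_α⁻¹·𝔞_η·P̌_{α,η}(x)·y)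 + 𝔞_β·𝔞_γ⁻¹·P̌_{α,η}(𝔞_β⁻¹·𝔞_γ·x·P̌_{β,γ}(y)). -/
/-- In an `Ω`-matching twisted Rota-Baxter algebra `(R, P_Ω, 𝔞_Ω)` of
weight 0 over a field `k` of characteristic 0, the doubly-indexed conjugated operators
`P̌_{ω,ω'}(r) = 𝔞_{ω'}⁻¹·P_ω(𝔞_{ω'}·r)` satisfy
`P̌_{α,η}(x)·P̌_{β,γ}(y) = 𝔞_α𝔞_η⁻¹·P̌_{β,γ}(𝔞_α⁻¹𝔞_η·P̌_{α,η}(x)·y)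
  + 𝔞_β𝔞_γ⁻¹·P̌_{α,η}(𝔞_β⁻¹𝔞_γ·x·P̌_{β,γ}(y))`. -/
theorem mtrba_conj_identity_two
    (k : Type*) [Field k] [CharZero k]
    (R : Type*) [CommRing R] [Algebra k R]
    (Ω : Type*) (P : Ω → R →ₗ[k] R) (a : Ω → Rˣ)
    (hmtrb : ∀ (α β : Ω) (x y : R),
      P α x * P β y =
        (a α : R) * P β ((↑(a α)⁻¹ : R) * P α x * y) +
          (a β : R) * P α ((↑(a β)⁻¹ : R) * x * P β y)) :
    ∀ (α β η γ : Ω) (x y : R),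
      conjOp (P α) (a η) x * conjOp (P β) (a γ) y =
        (a α : R) * (↑(a η)⁻¹ : R) *
            conjOp (P β) (a γ)
              ((↑(a α)⁻¹ : R) * (a η : R) * conjOp (P α) (a η) x * y) +
          (a β : R) * (↑(a γ)⁻¹ : R) *
            conjOp (P α) (a η)
              ((↑(a β)⁻¹ : R) * (a γ : R) * x * conjOp (P β) (a γ) y) := by
  intro α β η γ x y
  have hη : (a η : R) * (↑(a η)⁻¹ : R) = 1 := (a η).mul_inv
  have hγ : (a γ : R) * (↑(a γ)⁻¹ : R) = 1 := (a γ).mul_inv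
  simp only [conjOp]
  have arg_β : (a γ : R) * ((↑(a α)⁻¹ : R) * (a η : R) *
      ((↑(a η)⁻¹ : R) * P α ((a η : R) * x)) * y) =
      (↑(a α)⁻¹ : R) * P α ((a η : R) * x) * ((a γ : R) * y) := by
    linear_combination
      (a γ : R) * (↑(a α)⁻¹ : R) * P α ((a η : R) * x) * y * hη
  have arg_α : (a η : R) * ((↑(a β)⁻¹ : R) * (a γ : R) * x *
      ((↑(a γ)⁻¹ : R) * P β ((a γ : R) * y))) =
      (↑(a β)⁻¹ : R) * ((a η : R) * x) * P β ((a γ : R) * y) := by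
    linear_combination
      (a η : R) * (↑(a β)⁻¹ : R) * x * P β ((a γ : R) * y) * hγ
  rw [arg_β, arg_α]
  linear_combination (↑(a η)⁻¹ : R) * (↑(a γ)⁻¹ : R) *
    hmtrb α β ((a η : R) * x) ((a γ : R) * y)
end

section
/- Define the Volterra operator P on continuous functions on ℝ with kernel K(x,t) = x and lower limit a = 0, i.e. P(f)(x) := ∫_0^x x·f(t) dt. Then P(1)(x) = x², P(1)(x)·P(1)(x) = x⁴, and P(1·P(1))(x) + P(P(1)·1)(x) = (2/3)·x⁴; consequently, for every real x ≠ 0, P(1)(x)·P(1)(x) ≠ P(1·P(1))(x) + P(P(1)·1)(x), so P is not a Rota-Baxter operator of weight 0. -/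
/-- The Volterra operator with kernel `K(x,t) = x` and lower limit `a = 0`:
`P(f)(x) := ∫_0^x x·f(t) dt`. -/
noncomputable def volterraX (f : ℝ → ℝ) (x : ℝ) : ℝ :=
  ∫ t in (0:ℝ)..x, x * f t

theorem volterraX_one (x : ℝ) : volterraX (fun _ => 1) x = x ^ 2 := by
  simp [volterraX, sq]

theorem volterraX_sq (x : ℝ) : volterraX (fun t => t ^ 2) x = x ^ 4 / 3 := by
  simp only [volterraX, intervalIntegral.integral_const_mul, integral_pow]
  norm_num
  ring

/-- For the Volterra operator `P(f)(x) = ∫_0^x x·f(t) dt` we have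
`P(1)(x) = x²`, `P(1)(x)·P(1)(x) = x⁴`, `P(1·P(1))(x) + P(P(1)·1)(x) = (2/3)x⁴`, and hence
for every `x ≠ 0` the weight-0 Rota-Baxter identity fails at `x`; so `P` is not a
Rota-Baxter operator of weight 0. -/
theorem volterraX_not_rota_baxter :
    (∀ x : ℝ, volterraX (fun _ => 1) x = x ^ 2) ∧
    (∀ x : ℝ, volterraX (fun _ => 1) x * volterraX (fun _ => 1) x = x ^ 4) ∧
    (∀ x : ℝ,
      volterraX (fun t => 1 * volterraX (fun _ => 1) t) x +
          volterraX (fun t => volterraX (fun _ => 1) t * 1) x =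
        (2 / 3) * x ^ 4) ∧
    (∀ x : ℝ, x ≠ 0 →
      volterraX (fun _ => 1) x * volterraX (fun _ => 1) x ≠
        volterraX (fun t => 1 * volterraX (fun _ => 1) t) x +
          volterraX (fun t => volterraX (fun _ => 1) t * 1) x) := by
  have hsum (x : ℝ) :
      volterraX (fun t => 1 * volterraX (fun _ => 1) t) x +
          volterraX (fun t => volterraX (fun _ => 1) t * 1) x =
        (2 / 3) * x ^ 4 := by
    simp only [one_mul, mul_one, volterraX_one, volterraX_sq]
    ring
  refine ⟨volterraX_one, fun x => ?_, hsum, fun x hx h => ?_⟩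
  · rw [volterraX_one]
    ring
  · rw [hsum, volterraX_one] at h
    have : x ^ 4 = 0 := by linarith
    exact hx (pow_eq_zero_iff (by norm_num) |>.mp this)
end

section
/- Fix a ∈ ℝ and define the Volterra operator P on continuous functions on ℝ by P(f)(x) := ∫_a^x e^{t−x}·f(t) dt (separable kernel K(x,t) = e^{−x}·e^{t}). Then for all continuous f, g : ℝ → ℝ and all x ∈ ℝ, the Reynolds identity holds: P(f)(x)·P(g)(x) = P(f·P(g))(x) + P(P(f)·g)(x) − P(P(f)·P(g))(x). -/
/-- The Volterra operator with separable kernel `K(x,t) = e^{t−x}` and lower limit `a`: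
`P(f)(x) := ∫_a^x e^{t−x}·f(t) dt`. -/
noncomputable def volterraExp (a : ℝ) (f : ℝ → ℝ) (x : ℝ) : ℝ :=
  ∫ t in a..x, Real.exp (t - x) * f t

theorem volterraExp_eq_exp_neg_mul (a : ℝ) (f : ℝ → ℝ) (x : ℝ) :
    volterraExp a f x = Real.exp (-x) * ∫ t in a..x, Real.exp t * f t := by
  rw [volterraExp, ← intervalIntegral.integral_const_mul]
  refine intervalIntegral.integral_congr fun t _ => ?_
  simp only [sub_eq_neg_add, Real.exp_add, mul_assoc]

theorem volterraExp_self (a : ℝ) (f : ℝ → ℝ) : volterraExp a f a = 0 :=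
  intervalIntegral.integral_same

theorem hasDerivAt_volterraExp (a : ℝ) {f : ℝ → ℝ} (hf : Continuous f) (x : ℝ) :
    HasDerivAt (volterraExp a f) (f x - volterraExp a f x) x := by
  have hc : Continuous fun t => Real.exp t * f t := Real.continuous_exp.mul hf
  have hI := hc.integral_hasStrictDerivAt a x |>.hasDerivAt
  have hE : HasDerivAt (fun y : ℝ => Real.exp (-y)) (Real.exp (-x) * -1) x :=
    (hasDerivAt_neg x).exp
  rw [funext (volterraExp_eq_exp_neg_mul a f)]
  refine (hE.mul hI).congr_deriv ?_
  have hx : Real.exp (-x) * Real.exp x = 1 := by rw [← Real.exp_add]; simp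
  linear_combination f x * hx

theorem continuous_volterraExp (a : ℝ) {f : ℝ → ℝ} (hf : Continuous f) :
    Continuous (volterraExp a f) :=
  continuous_iff_continuousAt.2 fun x => (hasDerivAt_volterraExp a hf x).continuousAt

/-- `volterraExp a h` is the solution of `u' + u = h` vanishing at `a`. -/
theorem volterraExp_eq_of_hasDerivAt {a : ℝ} {u h : ℝ → ℝ} (hh : Continuous h)
    (hu : ∀ x, HasDerivAt u (h x - u x) x) (ha : u a = 0) (x : ℝ) :
    volterraExp a h x = u x := by
  have hd : ∀ t ∈ Set.uIcc a x,
      HasDerivAt (fun t => Real.exp (t - x) * u t) (Real.exp (t - x) * h t) t := by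
    intro t _
    refine ((((hasDerivAt_id t).sub_const x).exp).mul (hu t)).congr_deriv ?_
    simp only [id]
    ring
  rw [volterraExp, intervalIntegral.integral_eq_sub_of_hasDerivAt hd
    (Continuous.intervalIntegrable (by fun_prop) _ _)]
  simp [ha]

theorem volterraExp_add (a : ℝ) {f g : ℝ → ℝ} (hf : Continuous f) (hg : Continuous g) (x : ℝ) :
    volterraExp a (fun t => f t + g t) x = volterraExp a f x + volterraExp a g x := by
  simp only [volterraExp, mul_add]
  exact intervalIntegral.integral_add (Continuous.intervalIntegrable (by fun_prop) _ _)
    (Continuous.intervalIntegrable (by fun_prop) _ _)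

theorem volterraExp_sub (a : ℝ) {f g : ℝ → ℝ} (hf : Continuous f) (hg : Continuous g) (x : ℝ) :
    volterraExp a (fun t => f t - g t) x = volterraExp a f x - volterraExp a g x := by
  simp only [volterraExp, mul_sub]
  exact intervalIntegral.integral_sub (Continuous.intervalIntegrable (by fun_prop) _ _)
    (Continuous.intervalIntegrable (by fun_prop) _ _)

/-- The Volterra operator `P(f)(x) = ∫_a^x e^{t−x}f(t) dt` satisfies the
Reynolds identity `P(f)P(g) = P(fP(g)) + P(P(f)g) − P(P(f)P(g))` on continuous functions. -/
theorem volterraExp_reynolds (a : ℝ) (f g : ℝ → ℝ)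
    (hf : Continuous f) (hg : Continuous g) :
    ∀ x : ℝ,
      volterraExp a f x * volterraExp a g x =
        volterraExp a (fun t => f t * volterraExp a g t) x +
          volterraExp a (fun t => volterraExp a f t * g t) x -
            volterraExp a (fun t => volterraExp a f t * volterraExp a g t) x := by
  intro x
  have hPf := continuous_volterraExp a hf
  have hPg := continuous_volterraExp a hg
  have hfPg : Continuous fun t => f t * volterraExp a g t := hf.mul hPg
  have hPfg : Continuous fun t => volterraExp a f t * g t := hPf.mul hg
  have hPfPg : Continuous fun t => volterraExp a f t * volterraExp a g t := hPf.mul hPg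
  rw [← volterraExp_add a hfPg hPfg, ← volterraExp_sub a (by fun_prop) hPfPg]
  refine (volterraExp_eq_of_hasDerivAt (u := fun t => volterraExp a f t * volterraExp a g t)
    (by fun_prop) (fun t => ?_) ?_ x).symm
  · refine ((hasDerivAt_volterraExp a hf t).mul (hasDerivAt_volterraExp a hg t)).congr_deriv ?_
    ring
  · simp [volterraExp_self]
end

section
/- Define the Volterra operator P on continuous functions on ℝ by P(f)(x) := ∫_0^x e^{t−x}·f(t) dt (kernel K(x,t) = e^{−x+t}, lower limit a = 0), and the twist 𝔞(x) := e^{−x}. Then for all continuous f, g, h : ℝ → ℝ and all x ∈ ℝ: P(f·P(g))(x)·P(h)(x) − P(f·P(h))(x)·P(g)(x) = 𝔞(x)·P(t ↦ e^{t}·h(t)·P(f·P(g))(t))(x) − 𝔞(x)·P(t ↦ e^{t}·g(t)·P(f·P(h))(t))(x); equivalently, the left-hand side equals e^{−x}∫_0^x e^{t−x}( e^{t} h(t) ∫_0^t e^{u−t} f(u) ∫_0^u e^{s−u} g(s) ds du ) dt − e^{−x}∫_0^x e^{t−x}( e^{t} g(t) ∫_0^t e^{u−t} f(u) ∫_0^u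 e^{s−u} h(s) ds du ) dt, an operator-linear expression in which each iterated integral acts on the variable functions f, g, h. -/
/-- The Volterra operator with kernel `K(x,t) = e^{t−x}` and lower limit `0`:
`P(f)(x) := ∫_0^x e^{t−x}·f(t) dt`. -/
noncomputable def volterraExp0 (f : ℝ → ℝ) (x : ℝ) : ℝ :=
  ∫ t in (0:ℝ)..x, Real.exp (t - x) * f t

theorem volterraExp0_eq (f : ℝ → ℝ) (x : ℝ) :
    volterraExp0 f x = Real.exp (-x) * ∫ t in (0:ℝ)..x, Real.exp t * f t := by
  rw [volterraExp0, ← intervalIntegral.integral_const_mul]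
  congr 1
  funext t
  rw [sub_eq_add_neg, Real.exp_add]
  ring

theorem continuous_volterraExp0 {f : ℝ → ℝ} (hf : Continuous f) :
    Continuous (volterraExp0 f) := by
  rw [funext (volterraExp0_eq f)]
  have hc : Continuous fun t => Real.exp t * f t := by fun_prop
  exact (by fun_prop : Continuous fun x : ℝ => Real.exp (-x)).mul
    (intervalIntegral.continuous_primitive (fun _ _ => hc.intervalIntegrable _ _) 0)

/-- The twisted Rota-Baxter identity for `volterraExp0`, with twist `e^{-x}`. -/
theorem volterraExp0_mul {f g : ℝ → ℝ} (hf : Continuous f) (hg : Continuous g) (x : ℝ) :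
    volterraExp0 f x * volterraExp0 g x =
      Real.exp (-x) * volterraExp0 (fun t => Real.exp t * g t * volterraExp0 f t) x +
        Real.exp (-x) * volterraExp0 (fun t => Real.exp t * f t * volterraExp0 g t) x := by
  have hcf : Continuous fun t => Real.exp t * f t := by fun_prop
  have hcg : Continuous fun t => Real.exp t * g t := by fun_prop
  have hPf := continuous_volterraExp0 hf
  have hPg := continuous_volterraExp0 hg
  have parts := intervalIntegral.integral_deriv_mul_eq_sub (a := 0) (b := x)
    (fun t _ => hcf.integral_hasStrictDerivAt 0 t |>.hasDerivAt)
    (fun t _ => hcg.integral_hasStrictDerivAt 0 t |>.hasDerivAt)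
    (hcf.intervalIntegrable _ _) (hcg.intervalIntegrable _ _)
  have primitive_eq (k : ℝ → ℝ) (t : ℝ) :
      ∫ s in (0:ℝ)..t, Real.exp s * k s = Real.exp t * volterraExp0 k t := by
    rw [volterraExp0_eq, ← mul_assoc, ← Real.exp_add, add_neg_cancel, Real.exp_zero, one_mul]
  simp only [intervalIntegral.integral_same, mul_zero, sub_zero] at parts
  rw [volterraExp0_eq f x, volterraExp0_eq g x, mul_mul_mul_comm, ← parts,
    volterraExp0_eq _ x, volterraExp0_eq _ x, ← mul_add, ← mul_add,
    ← intervalIntegral.integral_add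
      ((by fun_prop : Continuous _).intervalIntegrable _ _)
      ((by fun_prop : Continuous _).intervalIntegrable _ _), mul_assoc]
  congr 3
  funext t
  rw [primitive_eq, primitive_eq]
  ring

/-- For the Volterra operator `P(f)(x) = ∫_0^x e^{t−x}f(t) dt` with twist
`𝔞(x) = e^{−x}`, for all continuous `f, g, h` and all `x`:
`P(fP(g))(x)·P(h)(x) − P(fP(h))(x)·P(g)(x)
  = 𝔞(x)·P(t ↦ e^t h(t) P(fP(g))(t))(x) − 𝔞(x)·P(t ↦ e^t g(t) P(fP(h))(t))(x)`,
and equivalently the left-hand side equals the operator-linear iterated-integral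
expression. -/
theorem volterraExp0_operator_linear (f g h : ℝ → ℝ)
    (hf : Continuous f) (hg : Continuous g) (hh : Continuous h) :
    ∀ x : ℝ,
      (volterraExp0 (fun t => f t * volterraExp0 g t) x * volterraExp0 h x -
          volterraExp0 (fun t => f t * volterraExp0 h t) x * volterraExp0 g x =
        Real.exp (-x) *
            volterraExp0
              (fun t => Real.exp t * h t *
                volterraExp0 (fun u => f u * volterraExp0 g u) t) x -
          Real.exp (-x) *
            volterraExp0
              (fun t => Real.exp t * g t *
                volterraExp0 (fun u => f u * volterraExp0 h u) t) x)
      ∧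
      (volterraExp0 (fun t => f t * volterraExp0 g t) x * volterraExp0 h x -
          volterraExp0 (fun t => f t * volterraExp0 h t) x * volterraExp0 g x =
        Real.exp (-x) *
            (∫ t in (0:ℝ)..x, Real.exp (t - x) *
              (Real.exp t * h t *
                ∫ u in (0:ℝ)..t, Real.exp (u - t) *
                  (f u * ∫ s in (0:ℝ)..u, Real.exp (s - u) * g s))) -
          Real.exp (-x) *
            (∫ t in (0:ℝ)..x, Real.exp (t - x) *
              (Real.exp t * g t *
                ∫ u in (0:ℝ)..t, Real.exp (u - t) *
                  (f u * ∫ s in (0:ℝ)..u, Real.exp (s - u) * h s)))) := by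
  intro x
  refine and_self_iff.mpr ?_
  rw [volterraExp0_mul (hf.fun_mul (continuous_volterraExp0 hg)) hh x,
    volterraExp0_mul (hf.fun_mul (continuous_volterraExp0 hh)) hg x]
  have symm_integrand : (fun t => Real.exp t * (f t * volterraExp0 g t) * volterraExp0 h t) =
      fun t => Real.exp t * (f t * volterraExp0 h t) * volterraExp0 g t := by
    funext t
    ring
  rw [symm_integrand]
  ring
end
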